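/- Suppose x is a point added to a locally finite planar point set ω in general position (ω ∪ {x} in general circular position, x not collinear with two points of ω, x in the interior of the convex hull of ω). Let C_x(ω) = D(ω) \ D(ω ∪ {x}) be the destroyed Delaunay triangles and C⁺_x(ω) = D(ω ∪ {x}) \ D(ω) the created ones. Then every destroyed triangle τ ∈ C_x(ω) satisfies x ∈ B(τ), and every created triangle τ ∈ C⁺_x(ω) contains x as a vertex, and the regions covered coincide: ∪_{τ ∈ C_x(ω)} conv(τ) = ∪_{τ ∈ C⁺_x(ω)} conv(τ). -/

import Mathlib

open Set Metric

/-- The Delaunay triangulation of a planar configuration `ω`: the 3-element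
subsets of `ω` whose open circumscribed disc contains no point of `ω`. -/
def delaunaySet (ω : Set (EuclideanSpace ℝ (Fin 2))) :
    Set (Set (EuclideanSpace ℝ (Fin 2))) :=
  {τ | τ ⊆ ω ∧ τ.ncard = 3 ∧
    ∃ (c : EuclideanSpace ℝ (Fin 2)) (r : ℝ), 0 < r ∧
      (∀ y ∈ τ, dist y c = r) ∧ Metric.ball c r ∩ ω = ∅}

open Filter Topology

local notation "Plane" => EuclideanSpace ℝ (Fin 2)

/-- The affine function `y ↦ ⟪g.1, y⟫ + g.2`. -/
noncomputable def affEval (g : Plane × ℝ) (y : Plane) : ℝ := inner ℝ g.1 y + g.2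

lemma affEval_add (g h : Plane × ℝ) (y : Plane) :
    affEval (g + h) y = affEval g y + affEval h y := by
  simp only [affEval, Prod.fst_add, Prod.snd_add, inner_add_left]; ring

lemma affEval_smul (t : ℝ) (g : Plane × ℝ) (y : Plane) :
    affEval (t • g) y = t * affEval g y := by
  simp only [affEval, Prod.smul_fst, Prod.smul_snd, real_inner_smul_left, smul_eq_mul]; ring

lemma affEval_combo (g : Plane × ℝ) (a b : ℝ) (hab : a + b = 1) (y z : Plane) :
    affEval g (a • y + b • z) = a * affEval g y + b * affEval g z := by
  simp only [affEval, inner_add_right, real_inner_smul_right]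
  linear_combination -g.2 * hab

lemma affEval_add_right (g : Plane × ℝ) (y z : Plane) :
    affEval g (y + z) = affEval g y + inner ℝ g.1 z := by
  simp only [affEval, inner_add_right]; ring

@[fun_prop]
lemma continuous_affEval_left (y : Plane) : Continuous fun g => affEval g y := by
  unfold affEval; fun_prop

lemma affEval_le_norm_mul_add (g : Plane × ℝ) (y : Plane) :
    affEval g y ≤ ‖g.1‖ * ‖y‖ + |g.2| :=
  add_le_add (real_inner_le_norm _ _) (le_abs_self _)

/-- The affine functions lying below `y ↦ ‖y‖ ^ 2` on `S`. -/
def minorants (S : Set Plane) : Set (Plane × ℝ) :=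
  {g | ∀ q ∈ S, affEval g q ≤ ‖q‖ ^ 2}

/-- The points of `S` at which `g` touches the paraboloid `y ↦ ‖y‖ ^ 2`. -/
def contactSet (S : Set Plane) (g : Plane × ℝ) : Set Plane :=
  {q ∈ S | affEval g q = ‖q‖ ^ 2}

lemma isClosed_minorants (S : Set Plane) : IsClosed (minorants S) := by
  have : minorants S = ⋂ q ∈ S, {g | affEval g q ≤ ‖q‖ ^ 2} := by
    ext g; simp [minorants]
  rw [this]
  exact isClosed_biInter fun q _ => isClosed_le (by fun_prop) continuous_const

lemma norm_le_of_sq_le_affEval {g : Plane × ℝ} {y : Plane} (h : ‖y‖ ^ 2 ≤ affEval g y) :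
    ‖y‖ ≤ 1 + ‖g.1‖ + |g.2| := by
  have h1 := h.trans (affEval_le_norm_mul_add g y)
  by_contra! h2
  nlinarith [norm_nonneg y, norm_nonneg g.1, abs_nonneg g.2]

lemma exists_affEval_le_of_mem_convexHull {S : Set Plane} {y : Plane}
    (hy : y ∈ convexHull ℝ S) : ∃ M, ∀ g ∈ minorants S, affEval g y ≤ M := by
  have hc : Convex ℝ {y : Plane | ∃ M, ∀ g ∈ minorants S, affEval g y ≤ M} := by
    rintro y ⟨M, hM⟩ z ⟨N, hN⟩ a b ha hb hab
    refine ⟨a * M + b * N, fun g hg => ?_⟩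
    rw [affEval_combo g a b hab]
    exact add_le_add (mul_le_mul_of_nonneg_left (hM g hg) ha)
      (mul_le_mul_of_nonneg_left (hN g hg) hb)
  have hsub : S ⊆ {y : Plane | ∃ M, ∀ g ∈ minorants S, affEval g y ≤ M} :=
    fun q hq => ⟨‖q‖ ^ 2, fun g hg => hg q hq⟩
  exact convexHull_min hsub hc hy

lemma exists_pos_add_smul_mem {A : Set Plane} {p : Plane} (hp : p ∈ interior A) (u : Plane) :
    ∃ δ : ℝ, 0 < δ ∧ p + δ • u ∈ A := by
  have hcont : Tendsto (fun δ : ℝ => p + δ • u) (𝓝[>] 0) (𝓝 p) := by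
    have : Continuous fun δ : ℝ => p + δ • u := by fun_prop
    simpa using (this.tendsto 0).mono_left nhdsWithin_le_nhds
  obtain ⟨δ, h1, h2⟩ := ((hcont.eventually (mem_interior_iff_mem_nhds.1 hp)).and
    self_mem_nhdsWithin).exists
  exact ⟨δ, h2, h1⟩

lemma exists_inner_le {S : Set Plane} {p : Plane} (hp : p ∈ interior (convexHull ℝ S))
    (s : ℝ) (u : Plane) :
    ∃ M, ∀ g ∈ minorants S, s ≤ affEval g p → inner ℝ g.1 u ≤ M := by
  obtain ⟨δ, hδ, hmem⟩ := exists_pos_add_smul_mem hp u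
  obtain ⟨M, hM⟩ := exists_affEval_le_of_mem_convexHull hmem
  refine ⟨(M - s) / δ, fun g hg hs => ?_⟩
  have := hM g hg
  rw [affEval_add_right, real_inner_smul_right] at this
  rw [le_div_iff₀ hδ]; linarith

/-- Minorants whose value at an interior point of the convex hull is bounded below form a
compact set. -/
lemma isCompact_minorants_ge {S : Set Plane} {p : Plane}
    (hp : p ∈ interior (convexHull ℝ S)) (s : ℝ) :
    IsCompact {g ∈ minorants S | s ≤ affEval g p} := by
  refine Metric.isCompact_of_isClosed_isBounded ?_ ?_
  · exact (isClosed_minorants S).inter (isClosed_le continuous_const (continuous_affEval_left p))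
  have hcoord : ∀ i : Fin 2, ∃ M, ∀ g ∈ minorants S, s ≤ affEval g p → |g.1 i| ≤ M := by
    intro i
    obtain ⟨M, hM⟩ := exists_inner_le hp s (EuclideanSpace.single i 1)
    obtain ⟨N, hN⟩ := exists_inner_le hp s (-EuclideanSpace.single i 1)
    refine ⟨max M N, fun g hg hs => abs_le'.2 ⟨?_, ?_⟩⟩
    · have := hM g hg hs
      simp only [EuclideanSpace.inner_single_right] at this
      simpa using Or.inl (by simpa using this)
    · have := hN g hg hs
      simp only [inner_neg_right, EuclideanSpace.inner_single_right] at this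
      simpa using Or.inr (by simpa using this)
  choose M hM using hcoord
  obtain ⟨N, hN⟩ := exists_affEval_le_of_mem_convexHull (interior_subset hp)
  have hfst : ∀ g ∈ minorants S, s ≤ affEval g p → ‖g.1‖ ≤ M 0 + M 1 := by
    intro g hg hs
    have h0 := hM 0 g hg hs
    have h1 := hM 1 g hg hs
    rw [EuclideanSpace.norm_eq, Fin.sum_univ_two]
    refine Real.sqrt_le_iff.2 ⟨by linarith [abs_nonneg (g.1 0), abs_nonneg (g.1 1)], ?_⟩
    simp only [Real.norm_eq_abs]
    nlinarith [abs_nonneg (g.1 0), abs_nonneg (g.1 1)]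
  refine isBounded_iff_forall_norm_le.2
    ⟨(M 0 + M 1) + (M 0 + M 1) * ‖p‖ + |s| + |N|, fun g ⟨hg, hs⟩ => ?_⟩
  have h1 := hfst g hg hs
  have h2 := hN g hg
  have h3 := abs_real_inner_le_norm g.1 p
  have h4 := mul_le_mul_of_nonneg_right h1 (norm_nonneg p)
  have h5 := (norm_nonneg g.1).trans h1
  have h6 := (mul_nonneg (norm_nonneg g.1) (norm_nonneg p)).trans h4
  obtain ⟨h7, h8⟩ := abs_le.1 h3
  simp only [affEval] at h2 hs
  rw [Prod.norm_def]
  refine max_le (by linarith [abs_nonneg s, abs_nonneg N]) ?_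
  rw [Real.norm_eq_abs, abs_le]
  constructor
  · linarith [neg_abs_le s, abs_nonneg N]
  · linarith [le_abs_self N, abs_nonneg s]

lemma finite_contactSet {S : Set Plane} (hlf : ∀ (c : Plane) (r : ℝ), (S ∩ closedBall c r).Finite)
    (g : Plane × ℝ) : (contactSet S g).Finite := by
  refine (hlf 0 (1 + ‖g.1‖ + |g.2|)).subset fun q hq => ⟨hq.1, ?_⟩
  rw [mem_closedBall_zero_iff]
  exact norm_le_of_sq_le_affEval hq.2.ge

/-- A minorant may be perturbed in any direction that is nonpositive on its contact set. -/
lemma eventually_add_smul_mem_minorants {S : Set Plane}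
    (hlf : ∀ (c : Plane) (r : ℝ), (S ∩ closedBall c r).Finite) {g h : Plane × ℝ}
    (hg : g ∈ minorants S) (hh : ∀ q ∈ contactSet S g, affEval h q ≤ 0) :
    ∀ᶠ t : ℝ in 𝓝[>] 0, g + t • h ∈ minorants S := by
  set R := 1 + (‖g.1‖ + ‖h.1‖) + (|g.2| + |h.2|) with hR
  have hnear : ∀ᶠ t : ℝ in 𝓝[>] 0, ∀ q ∈ S ∩ closedBall 0 R,
      affEval (g + t • h) q ≤ ‖q‖ ^ 2 := by
    refine (eventually_all_finite (hlf 0 R)).2 fun q hq => ?_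
    rcases (hg q hq.1).eq_or_lt with heq | hlt
    · filter_upwards [self_mem_nhdsWithin] with t ht
      rw [affEval_add, affEval_smul, heq]
      nlinarith [hh q ⟨hq.1, heq⟩, mem_Ioi.1 ht]
    · have hc : Tendsto (fun t : ℝ => affEval (g + t • h) q) (𝓝[>] 0) (𝓝 (affEval g q)) := by
        have : Continuous fun t : ℝ => affEval (g + t • h) q :=
          (continuous_affEval_left q).comp (by fun_prop)
        simpa using (this.tendsto 0).mono_left nhdsWithin_le_nhds
      exact (hc.eventually (gt_mem_nhds hlt)).mono fun t => le_of_lt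
  filter_upwards [hnear, Ioo_mem_nhdsGT (zero_lt_one' ℝ)] with t ht ht1 q hq
  by_contra! hlt
  refine hlt.not_ge (ht q ⟨hq, ?_⟩)
  rw [mem_closedBall_zero_iff]
  refine (norm_le_of_sq_le_affEval hlt.le).trans ?_
  have h1 : ‖(g + t • h).1‖ ≤ ‖g.1‖ + ‖h.1‖ := by
    refine (norm_add_le _ _).trans (add_le_add_right ?_ _)
    rw [Prod.smul_fst, norm_smul, Real.norm_of_nonneg ht1.1.le]
    exact mul_le_of_le_one_left (norm_nonneg _) ht1.2.le
  have h2 : |(g + t • h).2| ≤ |g.2| + |h.2| := by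
    refine (abs_add_le _ _).trans (add_le_add_right ?_ _)
    rw [Prod.smul_snd, smul_eq_mul, abs_mul, abs_of_pos ht1.1]
    exact mul_le_of_le_one_left (abs_nonneg _) ht1.2.le
  linarith

lemma mem_convexHull_contactSet {S : Set Plane}
    (hlf : ∀ (c : Plane) (r : ℝ), (S ∩ closedBall c r).Finite) {g : Plane × ℝ} {p : Plane}
    (hg : g ∈ minorants S) (hmax : ∀ g' ∈ minorants S, affEval g' p ≤ affEval g p) :
    p ∈ convexHull ℝ (contactSet S g) := by
  by_contra hp
  obtain ⟨f, u, hfu, hup⟩ := geometric_hahn_banach_closed_point (convex_convexHull ℝ _)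
    ((finite_contactSet hlf g).isCompact_convexHull ℝ).isClosed hp
  set h : Plane × ℝ := ((InnerProductSpace.toDual ℝ Plane).symm f, -u) with hh
  have hval : ∀ y, affEval h y = f y - u := by
    intro y
    simp [affEval, hh, InnerProductSpace.toDual_symm_apply, sub_eq_add_neg]
  obtain ⟨t, ht, ht0⟩ := ((eventually_add_smul_mem_minorants hlf hg (h := h) fun q hq => by
    rw [hval]; linarith [hfu q (subset_convexHull ℝ _ hq)]).and self_mem_nhdsWithin).exists
  have h1 := hmax _ ht
  rw [affEval_add, affEval_smul, hval] at h1
  have ht0 : 0 < t := ht0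
  nlinarith

lemma exists_ne_zero_affEval_eq_zero {T : Set Plane} (hT : T.Finite) (hcard : T.ncard < 3) :
    ∃ h : Plane × ℝ, h ≠ 0 ∧ ∀ q ∈ T, affEval h q = 0 := by
  have := hT.fintype
  let L : Plane × ℝ →ₗ[ℝ] (T → ℝ) :=
    { toFun := fun g q => affEval g q
      map_add' := fun g h => funext fun q => affEval_add g h q
      map_smul' := fun t g => funext fun q => affEval_smul t g q }
  have hL : L.ker ≠ ⊥ := LinearMap.ker_ne_bot_of_finrank_lt (by
    rw [Module.finrank_fintype_fun_eq_card, Module.finrank_prod, finrank_euclideanSpace_fin,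
      Module.finrank_self, ← Nat.card_eq_fintype_card]
    exact hcard)
  obtain ⟨h, hker, hne⟩ := (Submodule.ne_bot_iff _).1 hL
  exact ⟨h, hne, fun q hq => congrFun (LinearMap.mem_ker.1 hker) ⟨q, hq⟩⟩

/-- Some minorant maximises the value at `p` and touches the paraboloid at three points. -/
lemma exists_minorant_maximal {S : Set Plane}
    (hlf : ∀ (c : Plane) (r : ℝ), (S ∩ closedBall c r).Finite) {p : Plane}
    (hp : p ∈ interior (convexHull ℝ S)) :
    ∃ g ∈ minorants S, (∀ g' ∈ minorants S, affEval g' p ≤ affEval g p) ∧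
      3 ≤ (contactSet S g).ncard := by
  have hzero : (0 : Plane × ℝ) ∈ {g ∈ minorants S | 0 ≤ affEval g p} := by
    refine ⟨fun q _ => ?_, ?_⟩ <;> simp [affEval]
  obtain ⟨g₀, ⟨hg₀, hg₀p⟩, hmax₀⟩ := (isCompact_minorants_ge hp 0).exists_isMaxOn ⟨0, hzero⟩
    (continuous_affEval_left p).continuousOn
  have hmax : ∀ g' ∈ minorants S, affEval g' p ≤ affEval g₀ p := fun g' hg' => by
    by_contra! hlt
    exact hlt.not_ge (hmax₀ ⟨hg', hg₀p.trans hlt.le⟩)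
  obtain ⟨g, ⟨hg, hgp⟩, hext⟩ := (isCompact_minorants_ge hp (affEval g₀ p)).extremePoints_nonempty
    ⟨g₀, hg₀, le_rfl⟩
  have hgmax : ∀ g' ∈ minorants S, affEval g' p ≤ affEval g p :=
    fun g' hg' => (hmax g' hg').trans hgp
  refine ⟨g, hg, hgmax, ?_⟩
  by_contra! hcard
  obtain ⟨h, hne, hh⟩ := exists_ne_zero_affEval_eq_zero (finite_contactSet hlf g) hcard
  obtain ⟨t, ⟨hplus, hminus⟩, ht⟩ := (((eventually_add_smul_mem_minorants hlf hg
    fun q hq => (hh q hq).le).and (eventually_add_smul_mem_minorants hlf hg (h := -h)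
    fun q hq => by
      rw [← neg_one_smul ℝ h, affEval_smul, hh q hq, mul_zero])).and self_mem_nhdsWithin).exists
  have hvp : affEval (g + t • h) p = affEval g p + t * affEval h p := by
    rw [affEval_add, affEval_smul]
  have hvm : affEval (g + t • -h) p = affEval g p - t * affEval h p := by
    rw [affEval_add, affEval_smul, ← neg_one_smul ℝ h, affEval_smul]; ring
  have hp1 := hgmax _ hplus
  have hm1 := hgmax _ hminus
  have hseg : g ∈ openSegment ℝ (g + t • h) (g + t • -h) :=
    ⟨1 / 2, 1 / 2, by norm_num, by norm_num, by norm_num, by module⟩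
  have heq := hext ⟨hplus, by linarith⟩ ⟨hminus, by linarith⟩ hseg
  have : t • h = 0 := by simpa using heq
  rcases smul_eq_zero.1 this with h0 | h0
  · exact (mem_Ioi.1 ht).ne' h0
  · exact hne h0

/-- The affine function agreeing with `‖y‖ ^ 2` on the circle with centre `c` and radius `r`. -/
noncomputable def circleAff (c : Plane) (r : ℝ) : Plane × ℝ := ((2 : ℝ) • c, r ^ 2 - ‖c‖ ^ 2)

lemma affEval_circleAff (c : Plane) (r : ℝ) (y : Plane) :
    affEval (circleAff c r) y = ‖y‖ ^ 2 - (dist y c ^ 2 - r ^ 2) := by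
  rw [dist_eq_norm, norm_sub_sq_real]
  simp only [affEval, circleAff, real_inner_smul_left, real_inner_comm c y]
  ring

lemma le_dist_of_ball_inter_eq_empty {S : Set Plane} {c y : Plane} {r : ℝ}
    (h : ball c r ∩ S = ∅) (hy : y ∈ S) : r ≤ dist y c := by
  by_contra! hlt
  exact (h ▸ (⟨hlt, hy⟩ : y ∈ ball c r ∩ S) : y ∈ (∅ : Set Plane))

lemma circleAff_mem_minorants {S : Set Plane} {c : Plane} {r : ℝ} (hr : 0 < r)
    (h : ball c r ∩ S = ∅) : circleAff c r ∈ minorants S := by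
  intro q hq
  have := le_dist_of_ball_inter_eq_empty h hq
  rw [affEval_circleAff]
  nlinarith

/-- The Delaunay triangles of a locally finite set cover the interior of its convex hull. -/
lemma exists_mem_delaunaySet_of_mem_interior {S : Set Plane}
    (hlf : ∀ (c : Plane) (r : ℝ), (S ∩ closedBall c r).Finite) {p : Plane}
    (hp : p ∈ interior (convexHull ℝ S)) : ∃ τ ∈ delaunaySet S, p ∈ convexHull ℝ τ := by
  obtain ⟨g, hg, hmax, hcard⟩ := exists_minorant_maximal hlf hp
  have hconv := mem_convexHull_contactSet hlf hg hmax
  rw [convexHull_eq_union] at hconv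
  simp only [mem_iUnion] at hconv
  obtain ⟨t, htT, hind, hpt⟩ := hconv
  have htcard : (t : Set Plane).ncard ≤ 3 := by
    have := hind.card_le_finrank_succ
    have h2 := Submodule.finrank_le (vectorSpan ℝ (range (Subtype.val : t → Plane)))
    rw [finrank_euclideanSpace_fin] at h2
    rw [Fintype.card_coe] at this
    rw [ncard_coe_finset]
    omega
  obtain ⟨τ, htτ, hτT, hτ⟩ := Set.exists_subsuperset_card_eq htT htcard hcard
  refine ⟨τ, ⟨fun q hq => (hτT hq).1, hτ, ?_⟩, convexHull_mono htτ hpt⟩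
  set c : Plane := (2⁻¹ : ℝ) • g.1 with hc
  set k : ℝ := g.2 + ‖c‖ ^ 2 with hk
  have hval : ∀ y, ‖y‖ ^ 2 - affEval g y = dist y c ^ 2 - k := by
    intro y
    have : g.1 = (2 : ℝ) • c := by rw [hc, smul_smul]; norm_num
    rw [dist_eq_norm, norm_sub_sq_real, affEval, this, real_inner_smul_left,
      real_inner_comm c y, hk]
    ring
  have hon : ∀ y ∈ τ, dist y c ^ 2 = k := fun y hy => by
    have := hval y
    rw [(hτT hy).2] at this
    linarith
  have hkpos : 0 < k := by
    obtain ⟨a, b, _, hab, _, _, rfl⟩ := ncard_eq_three.1 hτ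
    by_contra! hle
    have hcenter : ∀ y ∈ ({a, b, _} : Set Plane), y = c := fun y hy =>
      dist_eq_zero.1 (pow_eq_zero_iff two_ne_zero |>.1
        (le_antisymm ((hon y hy).trans_le hle) (sq_nonneg _)))
    exact hab ((hcenter a (by simp)).trans (hcenter b (by simp)).symm)
  refine ⟨c, √k, Real.sqrt_pos.2 hkpos, fun y hy => ?_, ?_⟩
  · rw [← hon y hy, Real.sqrt_sq dist_nonneg]
  · refine eq_empty_of_forall_notMem fun q hq => ?_
    have h1 := hg q hq.2
    have h2 : dist q c ^ 2 < k := (Real.lt_sqrt dist_nonneg).1 hq.1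
    linarith [hval q]

lemma interior_convexHull_nonempty_of_ncard_eq_three {τ : Set Plane} (hτ : τ.ncard = 3)
    {c : Plane} {r : ℝ} (hc : ∀ y ∈ τ, dist y c = r) : (interior (convexHull ℝ τ)).Nonempty := by
  obtain ⟨a, b, d, hab, had, hbd, rfl⟩ := ncard_eq_three.1 hτ
  have hind : AffineIndependent ℝ ![a, b, d] :=
    EuclideanGeometry.Cospherical.affineIndependent_of_ne ⟨c, r, hc⟩ hab had hbd
  rw [interior_convexHull_nonempty_iff_affineSpan_eq_top]
  have := hind.affineSpan_eq_top_iff_card_eq_finrank_add_one.2 (by simp)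
  rwa [Matrix.range_cons, Matrix.range_cons, Matrix.range_cons, Matrix.range_empty,
    union_empty, singleton_union, singleton_union] at this

/-- An affine function that is nonpositive on `A` and nonnegative on `B` vanishes identically as
soon as an interior point of the convex hull of `A` lies in the convex hull of `B`. -/
lemma affEval_eq_zero_of_mem_interior {A B : Set Plane} {g : Plane × ℝ} {p : Plane}
    (hA : ∀ y ∈ A, affEval g y ≤ 0) (hB : ∀ y ∈ B, 0 ≤ affEval g y)
    (hpA : p ∈ interior (convexHull ℝ A)) (hpB : p ∈ convexHull ℝ B) (y : Plane) :
    affEval g y = 0 := by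
  have hA' : ∀ y ∈ convexHull ℝ A, affEval g y ≤ 0 := by
    refine convexHull_min (t := {y | affEval g y ≤ 0}) hA ?_
    intro y hy z hz a b ha hb hab
    rw [mem_ofPred_eq, affEval_combo g a b hab]
    exact add_nonpos (mul_nonpos_of_nonneg_of_nonpos ha hy) (mul_nonpos_of_nonneg_of_nonpos hb hz)
  have hB' : ∀ y ∈ convexHull ℝ B, 0 ≤ affEval g y := by
    refine convexHull_min (t := {y | 0 ≤ affEval g y}) hB ?_
    intro y hy z hz a b ha hb hab
    rw [mem_ofPred_eq, affEval_combo g a b hab]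
    exact add_nonneg (mul_nonneg ha hy) (mul_nonneg hb hz)
  have hp : affEval g p = 0 := le_antisymm (hA' p (interior_subset hpA)) (hB' p hpB)
  obtain ⟨δ, hδ, hmem⟩ := exists_pos_add_smul_mem hpA g.1
  have h1 := hA' _ hmem
  rw [affEval_add_right, hp, real_inner_smul_right, real_inner_self_eq_norm_sq, zero_add] at h1
  have h2 : g.1 = 0 := by
    by_contra hne
    have := norm_pos_iff.2 hne
    exact h1.not_gt (by positivity)
  simpa [affEval, h2] using hp

/-- Two triangles inscribed in circles, each with no vertex inside the other circle, have the same
circumcircle if an interior point of one lies in the other. -/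
lemma power_eq_power_of_mem_interior {A B : Set Plane} {c c' p : Plane} {r r' : ℝ}
    (hr : 0 ≤ r) (hr' : 0 ≤ r')
    (hA : ∀ y ∈ A, dist y c = r) (hB : ∀ y ∈ B, dist y c' = r')
    (hA' : ∀ y ∈ A, r' ≤ dist y c') (hB' : ∀ y ∈ B, r ≤ dist y c)
    (hp : p ∈ interior (convexHull ℝ A) ∧ p ∈ convexHull ℝ B) (y : Plane) :
    dist y c ^ 2 - r ^ 2 = dist y c' ^ 2 - r' ^ 2 := by
  have hval : ∀ y, affEval (circleAff c' r' + (-1 : ℝ) • circleAff c r) y =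
      (dist y c ^ 2 - r ^ 2) - (dist y c' ^ 2 - r' ^ 2) := fun y => by
    rw [affEval_add, affEval_smul, affEval_circleAff, affEval_circleAff]; ring
  have := affEval_eq_zero_of_mem_interior (g := circleAff c' r' + (-1 : ℝ) • circleAff c r)
    (fun y hy => by rw [hval, hA y hy]; nlinarith [hA' y hy])
    (fun y hy => by rw [hval, hB y hy]; nlinarith [hB' y hy]) hp.1 hp.2 y
  rw [hval] at this
  linarith

/-- Only finitely many triangles have an empty circumscribed disc whose closure contains `x`. -/
lemma finite_setOf_circumscribed {ω : Set Plane} {x : Plane}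
    (hlf : ∀ (c : Plane) (r : ℝ), (ω ∩ closedBall c r).Finite)
    (hint : x ∈ interior (convexHull ℝ ω)) :
    {τ : Set Plane | τ ⊆ insert x ω ∧ ∃ (c : Plane) (r : ℝ), 0 < r ∧ (∀ y ∈ τ, dist y c = r) ∧
      ball c r ∩ ω = ∅ ∧ dist x c ≤ r}.Finite := by
  obtain ⟨R, hR⟩ := isBounded_iff_forall_norm_le.1
    (isCompact_minorants_ge hint (‖x‖ ^ 2)).isBounded
  refine (((hlf 0 (1 + R + R)).insert x).finite_subsets).subset ?_
  rintro τ ⟨hτ, c, r, hr, hc, hempty, hx⟩ y hy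
  rcases hτ hy with rfl | hyω
  · exact mem_insert _ _
  refine Or.inr ⟨hyω, ?_⟩
  have hb := hR (circleAff c r) ⟨circleAff_mem_minorants hr hempty, by
    rw [affEval_circleAff]; nlinarith [dist_nonneg (x := x) (y := c)]⟩
  have h1 := (norm_fst_le (circleAff c r)).trans hb
  have h2 := (norm_snd_le (circleAff c r)).trans hb
  rw [Real.norm_eq_abs] at h2
  rw [mem_closedBall_zero_iff]
  have h3 := norm_le_of_sq_le_affEval (g := circleAff c r) (y := y)
    (by rw [affEval_circleAff, hc y hy]; linarith)
  linarith

lemma mem_delaunaySet_of_mem_insert {ω τ : Set Plane} {x : Plane}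
    (hτ : τ ∈ delaunaySet (insert x ω)) (hx : x ∉ τ) : τ ∈ delaunaySet ω := by
  obtain ⟨hsub, hcard, c, r, hr, hc, hempty⟩ := hτ
  refine ⟨(subset_insert_iff_of_notMem hx).1 hsub, hcard, c, r, hr, hc, ?_⟩
  exact subset_eq_empty (inter_subset_inter_right _ (subset_insert x ω)) hempty

/-- A destroyed Delaunay triangle has an empty circumscribed disc that contains the new point. -/
lemma exists_ball_of_destroyed {ω τ : Set Plane} {x : Plane}
    (hτ : τ ∈ delaunaySet ω \ delaunaySet (insert x ω)) :
    ∃ (c : Plane) (r : ℝ), 0 < r ∧ (∀ y ∈ τ, dist y c = r) ∧ ball c r ∩ ω = ∅ ∧ dist x c < r := by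
  obtain ⟨⟨hsub, hcard, c, r, hr, hc, hempty⟩, hnot⟩ := hτ
  refine ⟨c, r, hr, hc, hempty, ?_⟩
  by_contra! hle
  refine hnot ⟨hsub.trans (subset_insert x ω), hcard, c, r, hr, hc, ?_⟩
  rw [inter_insert_of_notMem (by simpa using hle), hempty]

/-- A union of finitely many triangles is a closed set, so it contains any triangle whose interior
it contains. -/
lemma convexHull_subset_biUnion {F : Set (Set Plane)} (hF : F.Finite)
    (hfin : ∀ τ ∈ F, τ.ncard = 3) {τ : Set Plane} (hτ : τ.ncard = 3) {c : Plane} {r : ℝ}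
    (hc : ∀ y ∈ τ, dist y c = r)
    (h : interior (convexHull ℝ τ) ⊆ ⋃ σ ∈ F, convexHull ℝ σ) :
    convexHull ℝ τ ⊆ ⋃ σ ∈ F, convexHull ℝ σ := by
  have hclosed : IsClosed (⋃ σ ∈ F, convexHull ℝ σ) := hF.isClosed_biUnion fun σ hσ =>
    ((finite_of_ncard_pos (by rw [hfin σ hσ]; norm_num)).isCompact_convexHull ℝ).isClosed
  have := closure_minimal h hclosed
  rw [(convex_convexHull ℝ τ).closure_interior_eq_closure_of_nonempty_interior
    (interior_convexHull_nonempty_of_ncard_eq_three hτ hc)] at this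
  exact subset_closure.trans this

/-- When a point `x` inside the convex hull of a locally finite configuration `ω`
in general circular position is added: every destroyed Delaunay triangle has `x`
in its open circumscribed disc, every created triangle contains `x` as a vertex,
and the unions of the destroyed and of the created triangles coincide. -/
theorem delaunay_insert_point
    (ω : Set (EuclideanSpace ℝ (Fin 2))) (x : EuclideanSpace ℝ (Fin 2))
    (hlf : ∀ (c : EuclideanSpace ℝ (Fin 2)) (r : ℝ),
      (ω ∩ Metric.closedBall c r).Finite)
    (hx : x ∉ ω)
    (hgen : ∀ (c : EuclideanSpace ℝ (Fin 2)) (r : ℝ), 0 < r →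
      Metric.ball c r ∩ insert x ω = ∅ →
      (Metric.sphere c r ∩ insert x ω).ncard ≤ 3)
    (hcol : ∀ y ∈ ω, ∀ z ∈ ω, y ≠ z →
      ¬ Collinear ℝ ({x, y, z} : Set (EuclideanSpace ℝ (Fin 2))))
    (hint : x ∈ interior (convexHull ℝ ω)) :
    (∀ τ ∈ delaunaySet ω \ delaunaySet (insert x ω),
      ∀ (c : EuclideanSpace ℝ (Fin 2)) (r : ℝ), 0 < r →
        (∀ y ∈ τ, dist y c = r) → x ∈ Metric.ball c r) ∧
    (∀ τ ∈ delaunaySet (insert x ω) \ delaunaySet ω, x ∈ τ) ∧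
    (⋃ τ ∈ delaunaySet ω \ delaunaySet (insert x ω), convexHull ℝ τ) =
      (⋃ τ ∈ delaunaySet (insert x ω) \ delaunaySet ω, convexHull ℝ τ) := by
  have hlf' : ∀ (c : Plane) (r : ℝ), (insert x ω ∩ closedBall c r).Finite := fun c r =>
    ((hlf c r).insert x).subset fun y hy => hy.1.imp id fun h => ⟨h, hy.2⟩
  have hcreated : ∀ τ ∈ delaunaySet (insert x ω) \ delaunaySet ω, x ∈ τ := fun τ hτ => by
    by_contra hxτ
    exact hτ.2 (mem_delaunaySet_of_mem_insert hτ.1 hxτ)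
  refine ⟨fun τ hτ c' r' hr' hc' => ?_, hcreated, subset_antisymm ?_ ?_⟩
  · obtain ⟨c, r, hr, hc, -, hxc⟩ := exists_ball_of_destroyed hτ
    obtain ⟨p, hp⟩ := interior_convexHull_nonempty_of_ncard_eq_three hτ.1.2.1 hc
    have := power_eq_power_of_mem_interior hr.le hr'.le hc hc' (fun y hy => (hc' y hy).ge)
      (fun y hy => (hc y hy).ge) ⟨hp, interior_subset hp⟩ x
    rw [mem_ball]
    nlinarith [dist_nonneg (x := x) (y := c)]
  · have hfin : (delaunaySet (insert x ω) \ delaunaySet ω).Finite := by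
      refine (finite_setOf_circumscribed hlf hint).subset fun τ hτ => ?_
      obtain ⟨hsub, -, c, r, hr, hc, hempty⟩ := hτ.1
      exact ⟨hsub, c, r, hr, hc, subset_eq_empty
        (inter_subset_inter_right _ (subset_insert x ω)) hempty, (hc x (hcreated τ hτ)).le⟩
    refine iUnion₂_subset fun τ hτ => ?_
    obtain ⟨c, r, hr, hc, hempty, hxc⟩ := exists_ball_of_destroyed hτ
    refine convexHull_subset_biUnion hfin (fun σ hσ => hσ.1.2.1) hτ.1.2.1 hc fun p hp => ?_
    obtain ⟨σ, hσ, hpσ⟩ := exists_mem_delaunaySet_of_mem_interior hlf' (interior_mono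
      (convexHull_mono (hτ.1.1.trans (subset_insert x ω))) hp)
    refine mem_iUnion₂.2 ⟨σ, ⟨hσ, fun hσω => ?_⟩, hpσ⟩
    obtain ⟨hsub, -, c', r', hr', hc', hempty'⟩ := hσ
    have := power_eq_power_of_mem_interior hr.le hr'.le hc hc'
      (fun y hy => le_dist_of_ball_inter_eq_empty hempty' (Or.inr (hτ.1.1 hy)))
      (fun y hy => le_dist_of_ball_inter_eq_empty hempty (hσω.1 hy)) ⟨hp, hpσ⟩ x
    nlinarith [dist_nonneg (x := x) (y := c),
      le_dist_of_ball_inter_eq_empty hempty' (mem_insert x ω)]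
  · have hfin : (delaunaySet ω \ delaunaySet (insert x ω)).Finite := by
      refine (finite_setOf_circumscribed hlf hint).subset fun τ hτ => ?_
      obtain ⟨c, r, hr, hc, hempty, hxc⟩ := exists_ball_of_destroyed hτ
      exact ⟨hτ.1.1.trans (subset_insert x ω), c, r, hr, hc, hempty, hxc.le⟩
    have hhull : convexHull ℝ (insert x ω) ⊆ convexHull ℝ ω := convexHull_min
      (insert_subset (interior_subset hint) (subset_convexHull ℝ ω)) (convex_convexHull ℝ ω)
    refine iUnion₂_subset fun τ hτ => ?_
    obtain ⟨hsub, hcard, c, r, hr, hc, hempty⟩ := hτ.1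
    refine convexHull_subset_biUnion hfin (fun σ hσ => hσ.1.2.1) hcard hc fun p hp => ?_
    obtain ⟨σ, hσ, hpσ⟩ := exists_mem_delaunaySet_of_mem_interior hlf
      (interior_mono ((convexHull_mono hsub).trans hhull) hp)
    refine mem_iUnion₂.2 ⟨σ, ⟨hσ, fun hσx => ?_⟩, hpσ⟩
    obtain ⟨-, hcard', c', r', hr', hc', hempty'⟩ := hσx
    have := power_eq_power_of_mem_interior hr.le hr'.le hc hc'
      (fun y hy => le_dist_of_ball_inter_eq_empty hempty' (hsub hy))
      (fun y hy => le_dist_of_ball_inter_eq_empty hempty (Or.inr (hσ.1 hy))) ⟨hp, hpσ⟩ x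
    have hxc : dist x c' = r' := by
      rw [hc x (hcreated τ hτ)] at this
      exact (pow_left_inj₀ dist_nonneg hr'.le two_ne_zero).1 (by linarith)
    have hle : (insert x σ).ncard ≤ (sphere c' r' ∩ insert x ω).ncard :=
      ncard_le_ncard (insert_subset ⟨hxc, mem_insert x ω⟩
        fun y hy => ⟨hc' y hy, Or.inr (hσ.1 hy)⟩)
        ((hlf' c' r').subset fun y hy => ⟨hy.2, sphere_subset_closedBall hy.1⟩)
    rw [ncard_insert_of_notMem (fun h => hx (hσ.1 h))
      (finite_of_ncard_pos (by rw [hcard']; norm_num)), hcard'] at hle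
    linarith [hgen c' r' hr' hempty']
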